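/- arXiv:1903.02177 — 2 statements merged into one kernel-verified Lean document; each statement's English description precedes it below -/
import Mathlib

section
/- Let A be an atomic weakly associative relation algebra and let (B(A), T_κ, E_{κλ})_{κ,λ<3} be the suitable structure built from A. Then the complex algebra Cm B(A) satisfies the 2-ary merry-go-round identities: for every X ⊆ B(A) and all κ,λ,μ with {κ,λ,μ} = {0,1,2}, T*_κ(E_{κλ} ∩ T*_λ(E_{λμ} ∩ T*_μ(E_{μκ} ∩ T*_κ(X)))) = T*_κ(E_{κμ} ∩ T*_μ(E_{μλ} ∩ T*_λ(E_{λκ} ∩ T*_κ(X)))). -/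
universe u

/-- A weakly associative relation algebra: a Boolean algebra equipped with
relative multiplication `comp`, converse `conv`, and identity `one'`
satisfying the WA axioms. -/
structure WA (A : Type*) [BooleanAlgebra A] where
  comp : A → A → A
  conv : A → A
  one' : A
  wassoc : ∀ x : A, comp (comp (x ⊓ one') ⊤) ⊤ = comp (x ⊓ one') ⊤
  rdist : ∀ x y z : A, comp (x ⊔ y) z = comp x z ⊔ comp y z
  comp_one' : ∀ x : A, comp x one' = x
  conv_conv : ∀ x : A, conv (conv x) = x
  conv_sup : ∀ x y : A, conv (x ⊔ y) = conv x ⊔ conv y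
  conv_comp : ∀ x y : A, conv (comp x y) = comp (conv y) (conv x)
  tarski : ∀ x y : A, comp (conv x) (comp x y)ᶜ ≤ yᶜ

variable {A : Type u}

/-- The base set of the suitable structure of an atomic WA:
triples of atoms `s` with `s 1 ≤ s 2 ; s 0`. -/
def BAset [BooleanAlgebra A] (W : WA A) : Set (Fin 3 → A) :=
  {s | (∀ i : Fin 3, IsAtom (s i)) ∧ s 1 ≤ W.comp (s 2) (s 0)}

/-- The relation `T_κ = {(s,t) ∈ B(A)×B(A) : s κ = t κ}`. -/
def Tk [BooleanAlgebra A] (W : WA A) (κ : Fin 3) :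
    Set ((Fin 3 → A) × (Fin 3 → A)) :=
  {p | p.1 ∈ BAset W ∧ p.2 ∈ BAset W ∧ p.1 κ = p.2 κ}

/-- The sets `E_{κλ}`: all of `B(A)` when `κ = λ`, and otherwise the triples
whose entry at the third index `μ ∉ {κ,λ}` is a subidentity atom. -/
def Ee [BooleanAlgebra A] (W : WA A) (κ lam : Fin 3) : Set (Fin 3 → A) :=
  if κ = lam then BAset W
  else {s | s ∈ BAset W ∧ ∀ μ : Fin 3, μ ≠ κ → μ ≠ lam → s μ ≤ W.one'}

/-- The operator `T*_κ(X) = {s ∈ B(A) : s κ = t κ for some t ∈ X}`. -/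
def Tstar [BooleanAlgebra A] (W : WA A) (κ : Fin 3) (X : Set (Fin 3 → A)) :
    Set (Fin 3 → A) :=
  {s | s ∈ BAset W ∧ ∃ t ∈ X, s κ = t κ}

namespace WA

variable [BooleanAlgebra A] (W : WA A)

theorem conv_mono {x y : A} (h : x ≤ y) : W.conv x ≤ W.conv y := by
  rw [← sup_eq_right, ← W.conv_sup, sup_eq_right.2 h]

theorem conv_le_iff {x y : A} : W.conv x ≤ y ↔ x ≤ W.conv y :=
  ⟨fun h => by simpa only [W.conv_conv] using W.conv_mono h,
    fun h => by simpa only [W.conv_conv] using W.conv_mono h⟩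

/-- Converse as an order automorphism. -/
def convIso : A ≃o A where
  toFun := W.conv
  invFun := W.conv
  left_inv := W.conv_conv
  right_inv := W.conv_conv
  map_rel_iff' {x y} := by
    change W.conv x ≤ W.conv y ↔ x ≤ y
    rw [W.conv_le_iff, W.conv_conv]

theorem isAtom_conv {x : A} (hx : IsAtom x) : IsAtom (W.conv x) :=
  (W.convIso.isAtom_iff x).2 hx

theorem comp_mono_left {x y : A} (h : x ≤ y) (z : A) : W.comp x z ≤ W.comp y z := by
  rw [← sup_eq_right, ← W.rdist, sup_eq_right.2 h]

theorem comp_mono_right {x y : A} (z : A) (h : x ≤ y) : W.comp z x ≤ W.comp z y := by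
  have := W.conv_mono (W.comp_mono_left (W.conv_mono h) (W.conv z))
  simpa only [W.conv_comp, W.conv_conv] using this

theorem conv_one' : W.conv W.one' = W.one' := by
  have h := W.conv_comp (W.conv W.one') W.one'
  rw [W.comp_one', W.conv_conv, W.comp_one'] at h
  exact h.symm

theorem one'_comp (x : A) : W.comp W.one' x = x := by
  have h := W.conv_comp (W.conv x) W.one'
  rw [W.comp_one', W.conv_conv, W.conv_one'] at h
  exact h.symm

theorem disjoint_conv_comp {x y z : A} (h : Disjoint z (W.comp x y)) :
    Disjoint (W.comp (W.conv x) z) y :=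
  le_compl_iff_disjoint_right.1 <|
    (W.comp_mono_right _ (le_compl_iff_disjoint_right.2 h)).trans (W.tarski x y)

theorem le_comp_of_le_conv_comp {x y z : A} (hy : IsAtom y) (hz : IsAtom z)
    (h : z ≤ W.comp (W.conv x) y) : y ≤ W.comp x z := by
  by_contra hn
  have hd := W.disjoint_conv_comp (hy.not_le_iff_disjoint.1 hn)
  exact hz.1 (disjoint_self.1 (hd.mono_left h))

theorem exists_atom_le_conv_comp (hatomic : ∀ x : A, x ≠ ⊥ → ∃ a : A, IsAtom a ∧ a ≤ x)
    {y : A} (hy : IsAtom y) :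
    ∃ e, IsAtom e ∧ e ≤ W.one' ∧ e ≤ W.comp (W.conv y) y := by
  have hne : W.one' ⊓ W.comp (W.conv y) y ≠ ⊥ := by
    intro h
    have hd := W.disjoint_conv_comp (disjoint_iff.2 h)
    rw [W.conv_conv, W.comp_one'] at hd
    exact hy.1 (disjoint_self.1 hd)
  obtain ⟨e, he, hle⟩ := hatomic _ hne
  exact ⟨e, he, le_inf_iff.1 hle⟩

theorem exists_atom_le_comp_right (hatomic : ∀ x : A, x ≠ ⊥ → ∃ a : A, IsAtom a ∧ a ≤ x)
    {y : A} (hy : IsAtom y) : ∃ e, IsAtom e ∧ e ≤ W.one' ∧ y ≤ W.comp y e := by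
  obtain ⟨e, he, h1, h2⟩ := W.exists_atom_le_conv_comp hatomic hy
  exact ⟨e, he, h1, W.le_comp_of_le_conv_comp hy he h2⟩

theorem exists_atom_le_comp_left (hatomic : ∀ x : A, x ≠ ⊥ → ∃ a : A, IsAtom a ∧ a ≤ x)
    {y : A} (hy : IsAtom y) : ∃ e, IsAtom e ∧ e ≤ W.one' ∧ y ≤ W.comp e y := by
  obtain ⟨e, he, h1, h2⟩ := W.exists_atom_le_comp_right hatomic (W.isAtom_conv hy)
  refine ⟨W.conv e, W.isAtom_conv he, ?_, ?_⟩
  · rwa [W.conv_le_iff, W.conv_one']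
  · rwa [W.conv_le_iff, W.conv_comp, W.conv_conv] at h2

theorem eq_conv_of_le_comp {x y z : A} (hx : IsAtom x) (hy : IsAtom y) (hz : IsAtom z)
    (hz1 : z ≤ W.one') (h : z ≤ W.comp x y) : y = W.conv x := by
  rw [← W.conv_conv x] at h
  have h2 := W.le_comp_of_le_conv_comp hy hz h
  have h3 := h2.trans (W.comp_mono_right _ hz1)
  rw [W.comp_one'] at h3
  exact ((W.isAtom_conv hx).le_iff_eq hy.1).1 h3

/-- On the triples in `E_{κλ}` with `κ ≠ λ`, the entry at `λ` is this function of the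
entry at `κ`. -/
def transfer (κ lam : Fin 3) (y : A) : A :=
  if κ = 1 ∨ lam = 1 then y else W.conv y

theorem apply_eq_transfer {κ lam : Fin 3} (hne : κ ≠ lam) {s : Fin 3 → A}
    (hs : s ∈ Ee W κ lam) : s lam = W.transfer κ lam (s κ) := by
  rw [Ee, if_neg hne] at hs
  obtain ⟨⟨hat, hle⟩, hid⟩ := hs
  have h2 : s 2 ≤ W.one' → s 1 = s 0 := fun h =>
    ((hat 0).le_iff_eq (hat 1).1).1 <|
      (hle.trans (W.comp_mono_left h _)).trans_eq (W.one'_comp _)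
  have h0 : s 0 ≤ W.one' → s 1 = s 2 := fun h =>
    ((hat 2).le_iff_eq (hat 1).1).1 <|
      (hle.trans (W.comp_mono_right _ h)).trans_eq (W.comp_one' _)
  have h1 : s 1 ≤ W.one' → s 0 = W.conv (s 2) := fun h =>
    W.eq_conv_of_le_comp (hat 2) (hat 0) (hat 1) h hle
  fin_cases κ <;> fin_cases lam <;> simp [transfer] at hne hid ⊢
  · exact h2 (hid 2 (by decide) (by decide))
  · rw [h1 (hid 1 (by decide) (by decide)), W.conv_conv]
  · exact (h2 (hid 2 (by decide) (by decide))).symm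
  · exact (h0 (hid 0 (by decide) (by decide))).symm
  · exact h1 (hid 1 (by decide) (by decide))
  · exact h0 (hid 0 (by decide) (by decide))

theorem exists_mem_Ee (hatomic : ∀ x : A, x ≠ ⊥ → ∃ a : A, IsAtom a ∧ a ≤ x)
    {κ lam : Fin 3} (hne : κ ≠ lam) {y : A} (hy : IsAtom y) :
    ∃ s ∈ Ee W κ lam, s κ = y := by
  have hy' := W.isAtom_conv hy
  obtain ⟨d, hd, hd1, hdy⟩ := W.exists_atom_le_comp_left hatomic hy
  obtain ⟨r, hr, hr1, hry⟩ := W.exists_atom_le_comp_right hatomic hy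
  obtain ⟨e, he, he1, hey⟩ := W.exists_atom_le_conv_comp hatomic hy
  obtain ⟨f, hf, hf1, hfy⟩ := W.exists_atom_le_conv_comp hatomic hy'
  rw [W.conv_conv] at hfy
  simp only [Ee, if_neg hne, BAset, Set.mem_ofPred_eq, Fin.forall_fin_succ]
  fin_cases κ <;> fin_cases lam <;> simp at hne ⊢
  · exact ⟨![y, y, d], by simp [*]⟩
  · exact ⟨![y, e, W.conv y], by simp [*]⟩
  · exact ⟨![y, y, d], by simp [*]⟩
  · exact ⟨![r, y, y], by simp [*]⟩
  · exact ⟨![W.conv y, f, y], by simp [*]⟩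
  · exact ⟨![r, y, y], by simp [*]⟩

theorem isAtom_transfer (κ lam : Fin 3) {y : A} (hy : IsAtom y) :
    IsAtom (W.transfer κ lam y) := by
  unfold transfer
  split_ifs
  exacts [hy, W.isAtom_conv hy]

theorem exists_mem_Ee_inter_Tstar (hatomic : ∀ x : A, x ≠ ⊥ → ∃ a : A, IsAtom a ∧ a ≤ x)
    {κ lam : Fin 3} (hne : κ ≠ lam) {Y : Set (Fin 3 → A)} {y : A} (hy : IsAtom y) :
    (∃ t ∈ Ee W κ lam ∩ Tstar W lam Y, y = t κ) ↔ ∃ t ∈ Y, W.transfer κ lam y = t lam := by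
  constructor
  · rintro ⟨a, ⟨ha, -, t, ht, hat⟩, rfl⟩
    exact ⟨t, ht, by rw [← W.apply_eq_transfer hne ha, hat]⟩
  · rintro ⟨t, ht, hyt⟩
    obtain ⟨a, ha, rfl⟩ := W.exists_mem_Ee hatomic hne hy
    have haB : a ∈ BAset W := by
      rw [Ee, if_neg hne] at ha
      exact ha.1
    exact ⟨a, ⟨ha, haB, t, ht, by rw [W.apply_eq_transfer hne ha, hyt]⟩, rfl⟩

theorem transfer_cycle {κ lam μ : Fin 3} (hkl : κ ≠ lam) (hkm : κ ≠ μ) (hlm : lam ≠ μ) (y : A) :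
    W.transfer μ κ (W.transfer lam μ (W.transfer κ lam y)) = W.conv y := by
  fin_cases κ <;> fin_cases lam <;> fin_cases μ <;> simp [transfer] at hkl hkm hlm ⊢

/-- A merry-go-round of three substitutions acts as converse on the entry at `κ`. -/
theorem mem_merry_go_round (hatomic : ∀ x : A, x ≠ ⊥ → ∃ a : A, IsAtom a ∧ a ≤ x)
    {κ lam μ : Fin 3} (hkl : κ ≠ lam) (hkm : κ ≠ μ) (hlm : lam ≠ μ)
    {X : Set (Fin 3 → A)} {s : Fin 3 → A} :
    s ∈ Tstar W κ (Ee W κ lam ∩ Tstar W lam (Ee W lam μ ∩ Tstar W μ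
        (Ee W μ κ ∩ Tstar W κ X))) ↔
      s ∈ BAset W ∧ ∃ t ∈ X, W.conv (s κ) = t κ := by
  refine and_congr_right fun hs => ?_
  have h0 := hs.1 κ
  have h1 := W.isAtom_transfer κ lam h0
  have h2 := W.isAtom_transfer lam μ h1
  rw [W.exists_mem_Ee_inter_Tstar hatomic hkl h0, W.exists_mem_Ee_inter_Tstar hatomic hlm h1,
    W.exists_mem_Ee_inter_Tstar hatomic hkm.symm h2, W.transfer_cycle hkl hkm hlm]

end WA

/-- The complex algebra of the suitable structure of an atomic WA satisfies
the 2-ary merry-go-round identities. -/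
theorem stmt_10 [BooleanAlgebra A] (W : WA A)
    (hatomic : ∀ x : A, x ≠ ⊥ → ∃ a : A, IsAtom a ∧ a ≤ x)
    (X : Set (Fin 3 → A)) (hX : X ⊆ BAset W)
    (κ lam μ : Fin 3) (hkl : κ ≠ lam) (hkm : κ ≠ μ) (hlm : lam ≠ μ) :
    Tstar W κ (Ee W κ lam ∩ Tstar W lam (Ee W lam μ ∩ Tstar W μ (Ee W μ κ ∩ Tstar W κ X)))
      = Tstar W κ (Ee W κ μ ∩ Tstar W μ (Ee W μ lam ∩ Tstar W lam (Ee W lam κ ∩ Tstar W κ X))) := by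
  ext s
  rw [W.mem_merry_go_round hatomic hkl hkm hlm, W.mem_merry_go_round hatomic hkm hkl hlm.symm]
end

section
/- Let A be a weakly associative relation algebra, let z ∈ A, and let X ⊆ A be a subset whose supremum Σ X exists in A. Then the supremum of {z;x : x ∈ X} exists and equals z;(Σ X). Moreover, if X is nonempty, the supremum of {x⌣ : x ∈ X} exists and equals (Σ X)⌣. (Complete additivity of relative multiplication and converse.) -/
universe u

namespace WA

variable {A : Type u} [BooleanAlgebra A] (W : WA A)

theorem conv_mono_s13 : Monotone W.conv := fun x y h => by
  rw [← sup_eq_right] at h ⊢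
  rw [← W.conv_sup, h]

theorem comp_sup (x y z : A) : W.comp x (y ⊔ z) = W.comp x y ⊔ W.comp x z := by
  rw [← W.conv_conv (W.comp x (y ⊔ z)), W.conv_comp, W.conv_sup, W.rdist, W.conv_sup,
    W.conv_comp, W.conv_comp, W.conv_conv, W.conv_conv, W.conv_conv]

theorem comp_mono_right_s13 (z : A) : Monotone (W.comp z) := fun x y h => by
  rw [← sup_eq_right] at h ⊢
  rw [← W.comp_sup, h]

/-- Relative multiplication by `z` on the left has an upper adjoint. -/
theorem gc_comp (z : A) : GaloisConnection (W.comp z) fun b => (W.comp (W.conv z) bᶜ)ᶜ := by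
  intro x b
  constructor
  · intro h
    exact le_compl_comm.mp <|
      (W.comp_mono_right_s13 (W.conv z) (compl_le_compl h)).trans (W.tarski z x)
  · intro h
    have := W.tarski (W.conv z) bᶜ
    rw [W.conv_conv, compl_compl] at this
    exact (W.comp_mono_right_s13 z h).trans this

theorem gc_conv : GaloisConnection W.conv W.conv := fun x y =>
  ⟨fun h => by simpa only [W.conv_conv] using W.conv_mono_s13 h,
    fun h => by simpa only [W.conv_conv] using W.conv_mono_s13 h⟩

end WA

/-- Complete additivity of relative multiplication (on the right argument)
and of converse in a weakly associative relation algebra. -/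
theorem stmt_13 {A : Type u} [BooleanAlgebra A] (W : WA A)
    (z s : A) (X : Set A) (hs : IsLUB X s) :
    IsLUB ((fun x => W.comp z x) '' X) (W.comp z s) ∧
    (X.Nonempty → IsLUB (W.conv '' X) (W.conv s)) := by
  exact ⟨(W.gc_comp z).isLUB_l_image hs, fun _ => W.gc_conv.isLUB_l_image hs⟩
end
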